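/- arXiv:2107.04988 — 5 statements merged into one kernel-verified Lean document; each statement's English description precedes it below -/
import Mathlib

section
/- Let T : H₁ → H₂ be a bounded ℂ-linear map between complex Hilbert spaces and let A, B > 0. Then T is sampling with bounds A, B (that is, A‖f‖² ≤ ‖Tf‖² ≤ B‖f‖² for all f ∈ H₁) if and only if the adjoint T* : H₂ → H₁ is interpolating with bounds A, B (that is, T* is surjective and for every c ∈ H₁ the minimal-norm solution f_c ∈ H₂ of T*(f) = c satisfies A‖f_c‖² ≤ ‖c‖² ≤ B‖f_c‖²). -/
/-- An element orthogonal to the kernel of `S` has minimal norm among the elements with the same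
image. -/
theorem ContinuousLinearMap.norm_le_of_mem_ker_orthogonal {𝕜 E F : Type*} [RCLike 𝕜]
    [NormedAddCommGroup E] [InnerProductSpace 𝕜 E] [NormedAddCommGroup F] [InnerProductSpace 𝕜 F]
    {S : E →L[𝕜] F} {u g : E} (hu : ∀ v : E, S v = 0 → inner 𝕜 u v = 0) (h : S g = S u) :
    ‖u‖ ≤ ‖g‖ := by
  have key := norm_add_sq_eq_norm_sq_add_norm_sq_of_inner_eq_zero u (g - u)
    (hu (g - u) (by rw [map_sub, h, sub_self]))
  rw [add_sub_cancel] at key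
  nlinarith [norm_nonneg g, norm_nonneg u, mul_self_nonneg ‖g - u‖]

/-- Every attained value of a bounded operator on a Hilbert space is attained at an element
orthogonal to the kernel. -/
theorem ContinuousLinearMap.exists_map_eq_and_ker_orthogonal {𝕜 E F : Type*} [RCLike 𝕜]
    [NormedAddCommGroup E] [InnerProductSpace 𝕜 E] [CompleteSpace E]
    [NormedAddCommGroup F] [InnerProductSpace 𝕜 F] (S : E →L[𝕜] F) (g : E) :
    ∃ u : E, S u = S g ∧ ∀ v : E, S v = 0 → inner 𝕜 u v = 0 := by
  let K : Submodule 𝕜 E := LinearMap.ker (S : E →ₗ[𝕜] F)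
  have : CompleteSpace K := S.isClosed_ker.completeSpace_coe
  obtain ⟨y, hy, u, hu, rfl⟩ := K.exists_add_mem_mem_orthogonal g
  have hy0 : S y = 0 := hy
  exact ⟨u, by rw [map_add, hy0, zero_add], fun v hv => K.inner_left_of_mem_orthogonal hv hu⟩

/-- If `A ‖f‖² ≤ ‖T f‖²` with `A > 0`, then `T† T` is surjective. -/
theorem ContinuousLinearMap.adjoint_comp_surjective_of_le {𝕜 E F : Type*} [RCLike 𝕜]
    [NormedAddCommGroup E] [InnerProductSpace 𝕜 E] [CompleteSpace E]
    [NormedAddCommGroup F] [InnerProductSpace 𝕜 F] [CompleteSpace F]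
    (T : E →L[𝕜] F) {A : ℝ} (hA : 0 < A) (h : ∀ f : E, A * ‖f‖ ^ 2 ≤ ‖T f‖ ^ 2) (c : E) :
    ∃ f : E, adjoint T (T f) = c := by
  have hunit : IsUnit (adjoint T ∘L T) := by
    refine isUnit_of_forall_le_norm_inner_map _ (c := ⟨A, hA.le⟩) hA fun f => ?_
    rw [comp_apply, adjoint_inner_left, inner_self_eq_norm_sq_to_K, norm_pow, RCLike.norm_ofReal,
      abs_norm, mul_comm]
    exact h f
  exact (isUnit_iff_bijective.mp hunit).surjective c


/-- a bounded `ℂ`-linear map `T : H₁ → H₂` between complex Hilbert spaces is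
sampling with bounds `A, B` iff its adjoint `T* : H₂ → H₁` is interpolating with bounds `A, B`
(i.e. `T*` is surjective and every minimal-norm solution `f` of `T* f = c` satisfies
`A ‖f‖² ≤ ‖c‖² ≤ B ‖f‖²`). -/
theorem sampling_iff_adjoint_interpolating
    {H₁ H₂ : Type*} [NormedAddCommGroup H₁] [InnerProductSpace ℂ H₁] [CompleteSpace H₁]
    [NormedAddCommGroup H₂] [InnerProductSpace ℂ H₂] [CompleteSpace H₂]
    (T : H₁ →L[ℂ] H₂) (A B : ℝ) (hA : 0 < A) (hB : 0 < B) :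
    (∀ f : H₁, A * ‖f‖ ^ 2 ≤ ‖T f‖ ^ 2 ∧ ‖T f‖ ^ 2 ≤ B * ‖f‖ ^ 2) ↔
      (Function.Surjective (ContinuousLinearMap.adjoint T) ∧
        ∀ c : H₁, ∀ f : H₂, ContinuousLinearMap.adjoint T f = c →
          (∀ g : H₂, ContinuousLinearMap.adjoint T g = c → ‖f‖ ≤ ‖g‖) →
          A * ‖f‖ ^ 2 ≤ ‖c‖ ^ 2 ∧ ‖c‖ ^ 2 ≤ B * ‖f‖ ^ 2) := by
  have sq_norm_map_le (f : H₁) : ‖T f‖ ^ 2 ≤ ‖f‖ * ‖ContinuousLinearMap.adjoint T (T f)‖ := by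
    have hle := norm_inner_le_norm (𝕜 := ℂ) f (ContinuousLinearMap.adjoint T (T f))
    rw [ContinuousLinearMap.adjoint_inner_right] at hle
    simpa [inner_self_eq_norm_sq_to_K] using hle
  have sq_norm_adjoint_le (g : H₂) : ‖ContinuousLinearMap.adjoint T g‖ ^ 2 ≤
      ‖T (ContinuousLinearMap.adjoint T g)‖ * ‖g‖ := by
    have hle := norm_inner_le_norm (𝕜 := ℂ) (T (ContinuousLinearMap.adjoint T g)) g
    rw [← ContinuousLinearMap.adjoint_inner_right] at hle
    simpa [inner_self_eq_norm_sq_to_K] using hle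
  constructor
  · intro h
    have hsurj := T.adjoint_comp_surjective_of_le hA fun f => (h f).1
    refine ⟨fun c => (hsurj c).imp' T fun _ => id, ?_⟩
    rintro _ f rfl hmin
    constructor
    · obtain ⟨u, hu⟩ := hsurj (ContinuousLinearMap.adjoint T f)
      have hle := hmin (T u) hu
      have hsq := sq_norm_map_le u
      rw [hu] at hsq
      have hlow := (h u).1
      set c := ‖ContinuousLinearMap.adjoint T f‖
      have hc : 0 ≤ c := norm_nonneg _
      have hA_u : A * ‖u‖ ≤ c := by
        rcases (norm_nonneg u).eq_or_lt with hu0 | hu0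
        · simpa [← hu0] using hc
        · nlinarith
      calc A * ‖f‖ ^ 2 ≤ A * ‖T u‖ ^ 2 := by gcongr
        _ ≤ A * (‖u‖ * c) := by gcongr
        _ = (A * ‖u‖) * c := by ring
        _ ≤ c * c := by gcongr
        _ = c ^ 2 := by ring
    · set g := ContinuousLinearMap.adjoint T f
      have hgg : ‖g‖ ^ 2 ≤ ‖T g‖ * ‖f‖ := sq_norm_adjoint_le f
      have hup := (h g).2
      rcases (norm_nonneg g).eq_or_lt with hg0 | hg0
      · rw [← hg0, zero_pow two_ne_zero]; positivity
      · refine le_of_mul_le_mul_right ?_ (pow_pos hg0 2)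
        calc ‖g‖ ^ 2 * ‖g‖ ^ 2 ≤ (‖T g‖ * ‖f‖) * (‖T g‖ * ‖f‖) := by gcongr
          _ = ‖T g‖ ^ 2 * ‖f‖ ^ 2 := by ring
          _ ≤ (B * ‖g‖ ^ 2) * ‖f‖ ^ 2 := by gcongr
          _ = B * ‖f‖ ^ 2 * ‖g‖ ^ 2 := by ring
  · rintro ⟨hsurj, h⟩ f
    constructor
    · obtain ⟨g, hg⟩ := hsurj f
      obtain ⟨u, hu, hker⟩ := (ContinuousLinearMap.adjoint T).exists_map_eq_and_ker_orthogonal g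
      rw [hg] at hu
      have hlow := (h f u hu fun v hv =>
        ContinuousLinearMap.norm_le_of_mem_ker_orthogonal hker (hv.trans hu.symm)).1
      have hff : ‖f‖ ^ 2 ≤ ‖T f‖ * ‖u‖ := hu ▸ sq_norm_adjoint_le u
      rcases (norm_nonneg f).eq_or_lt with hf0 | hf0
      · rw [← hf0, zero_pow two_ne_zero, mul_zero]; positivity
      · refine le_of_mul_le_mul_right ?_ (pow_pos hf0 2)
        calc A * ‖f‖ ^ 2 * ‖f‖ ^ 2 = A * (‖f‖ ^ 2 * ‖f‖ ^ 2) := by ring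
          _ ≤ A * ((‖T f‖ * ‖u‖) * (‖T f‖ * ‖u‖)) := by gcongr
          _ = ‖T f‖ ^ 2 * (A * ‖u‖ ^ 2) := by ring
          _ ≤ ‖T f‖ ^ 2 * ‖f‖ ^ 2 := by gcongr
    · have hup := (h _ (T f) rfl fun v hv =>
        ContinuousLinearMap.norm_le_of_mem_ker_orthogonal (fun w hw => by
          rw [← ContinuousLinearMap.adjoint_inner_right, hw, inner_zero_right]) hv).2
      have hsq := sq_norm_map_le f
      rcases (norm_nonneg (T f)).eq_or_lt with hf0 | hf0
      · rw [← hf0, zero_pow two_ne_zero]; positivity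
      · refine le_of_mul_le_mul_right ?_ (pow_pos hf0 2)
        set c := ‖ContinuousLinearMap.adjoint T (T f)‖
        calc ‖T f‖ ^ 2 * ‖T f‖ ^ 2 ≤ (‖f‖ * c) * (‖f‖ * c) := by gcongr
          _ = ‖f‖ ^ 2 * c ^ 2 := by ring
          _ ≤ ‖f‖ ^ 2 * (B * ‖T f‖ ^ 2) := by gcongr
          _ = B * ‖f‖ ^ 2 * ‖T f‖ ^ 2 := by ring
end

section
/- Let n ≥ 1, let F be an entire function on ℂⁿ, let γ ∈ ℂⁿ and let C > 0. Then ∫_{{z∈ℂⁿ : π|z−γ|² < C}} |F(z)|² e^{−π|z|²} dλ(z) ≥ |F(γ)|² e^{−π|γ|²} · (1 − e^{−C} Σ_{k=0}^{n−1} C^k/k!), where dλ is Lebesgue measure on ℂⁿ ≅ ℝ^{2n}; equivalently, the right-hand factor equals ∫₀^C e^{−t} t^{n−1}/(n−1)! dt. -/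
open MeasureTheory Complex

noncomputable section

/-- Multiplication by a unimodular scalar preserves Lebesgue measure on `ℂⁿ`. -/
lemma measurePreserving_unit_smul {n : ℕ} {c : ℂ} (hc : ‖c‖ = 1) :
    MeasurePreserving (fun w : Fin n → ℂ ↦ c • w) := by
  refine volume_preserving_pi (f := fun _ z ↦ c * z) fun _ ↦ ?_
  exact (rotation ⟨c, mem_sphere_zero_iff_norm.2 hc⟩).measurePreserving

lemma integrableOn_of_isBounded {X E : Type*} [MetricSpace X] [ProperSpace X]
    [MeasurableSpace X] [OpensMeasurableSpace X] {μ : Measure X} [IsFiniteMeasureOnCompacts μ]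
    [NormedAddCommGroup E] {f : X → E} (hf : Continuous f) {S : Set X}
    (hS : Bornology.IsBounded S) : IntegrableOn f S μ :=
  (hf.continuousOn.integrableOn_compact hS.isCompact_closure).mono_set subset_closure

/-- The mean value property of entire functions over a bounded set, with respect to a weight,
both invariant under multiplication by unimodular scalars. -/
lemma setIntegral_mul_eq_of_rotation_invariant {n : ℕ} {S : Set (Fin n → ℂ)}
    (hS : Bornology.IsBounded S) (hrot : ∀ c : ℂ, ‖c‖ = 1 → ∀ w, c • w ∈ S ↔ w ∈ S)
    {ρ : (Fin n → ℂ) → ℂ} (hρ : Continuous ρ) (hρrot : ∀ c : ℂ, ‖c‖ = 1 → ∀ w, ρ (c • w) = ρ w)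
    {g : (Fin n → ℂ) → ℂ} (hg : Differentiable ℂ g) :
    ∫ w in S, ρ w * g w = (∫ w in S, ρ w) * g 0 := by
  have hunit (θ : ℝ) : ‖circleMap 0 1 θ‖ = 1 := by simp
  have hinv (θ : ℝ) :
      ∫ w in S, ρ w * g (circleMap 0 1 θ • w) = ∫ w in S, ρ w * g w := by
    have h := (measurePreserving_unit_smul (n := n) (hunit θ)).setIntegral_preimage_emb
      (Homeomorph.smulOfNeZero (circleMap 0 1 θ) (by simp)).measurableEmbedding
      (fun w ↦ ρ w * g w) S
    have hpre : (fun w : Fin n → ℂ ↦ circleMap 0 1 θ • w) ⁻¹' S = S :=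
      Set.ext fun w ↦ hrot _ (hunit θ) w
    simpa only [hpre, hρrot _ (hunit θ)] using h
  have hmean (w : Fin n → ℂ) :
      ∫ θ in (0 : ℝ)..2 * Real.pi, g (circleMap 0 1 θ • w) = 2 * Real.pi * g 0 := by
    have hd : Differentiable ℂ fun z : ℂ ↦ g (z • w) := by fun_prop
    have h := (hd.diffContOnCl (s := Metric.ball 0 |1|)).circleAverage
    rw [Real.circleAverage_def, inv_smul_eq_iff₀ (by positivity)] at h
    simpa using h
  have hswap : ∫ θ in (0 : ℝ)..2 * Real.pi, ∫ w in S, ρ w * g (circleMap 0 1 θ • w) =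
      ∫ w in S, ∫ θ in (0 : ℝ)..2 * Real.pi, ρ w * g (circleMap 0 1 θ • w) := by
    refine intervalIntegral_integral_swap ?_
    rw [Measure.prod_restrict]
    refine integrableOn_of_isBounded ?_ (Bornology.IsBounded.prod ?_ hS)
    · have := hg.continuous
      have := continuous_circleMap 0 1
      simp only [Function.uncurry_def]
      fun_prop
    · exact (Metric.isBounded_Icc _ _).subset Set.uIoc_subset_uIcc
  simp only [hinv, intervalIntegral.integral_const_mul, hmean, intervalIntegral.integral_const,
    sub_zero, integral_mul_const] at hswap
  have hpi : (Real.pi : ℂ) ≠ 0 := by exact_mod_cast Real.pi_ne_zero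
  rw [Complex.real_smul] at hswap
  push_cast at hswap
  refine mul_left_cancel₀ (mul_ne_zero two_ne_zero hpi) (hswap.trans ?_)
  ring

/-- The sub-mean value property of `|g|²` for entire `g`, with respect to a nonnegative weight. -/
lemma norm_sq_mul_setIntegral_le {n : ℕ} {S : Set (Fin n → ℂ)}
    (hS : Bornology.IsBounded S) (hrot : ∀ c : ℂ, ‖c‖ = 1 → ∀ w, c • w ∈ S ↔ w ∈ S)
    {ρ : (Fin n → ℂ) → ℝ} (hρ : Continuous ρ) (hρ0 : ∀ w, 0 ≤ ρ w)
    (hρrot : ∀ c : ℂ, ‖c‖ = 1 → ∀ w, ρ (c • w) = ρ w)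
    {g : (Fin n → ℂ) → ℂ} (hg : Differentiable ℂ g) :
    ‖g 0‖ ^ 2 * ∫ w in S, ρ w ≤ ∫ w in S, ‖g w‖ ^ 2 * ρ w := by
  have hgc := hg.continuous
  set h : (Fin n → ℂ) → ℂ := fun w ↦ (ρ w : ℂ) * ((starRingEnd ℂ) (g 0) * g w) with hh
  have hhi : IntegrableOn h S := integrableOn_of_isBounded (by fun_prop) hS
  have hρi : IntegrableOn ρ S := integrableOn_of_isBounded hρ hS
  have hre : IntegrableOn (fun w ↦ (h w).re) S := hhi.re
  have hmean : ∫ w in S, (h w).re = ‖g 0‖ ^ 2 * ∫ w in S, ρ w := by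
    have h1 : ∫ w in S, (h w).re = (∫ w in S, h w).re := integral_re hhi
    have h2 := setIntegral_mul_eq_of_rotation_invariant hS hrot
      (ρ := fun w ↦ (ρ w : ℂ)) (by fun_prop) (fun c hc w ↦ by rw [hρrot c hc])
      (hg.const_mul ((starRingEnd ℂ) (g 0)))
    rw [h1, h2, integral_complex_ofReal, ← Complex.normSq_eq_conj_mul_self, ← Complex.ofReal_mul,
      Complex.ofReal_re, Complex.normSq_eq_norm_sq, mul_comm]
  have hle : ∫ w in S, (2 * (h w).re - ‖g 0‖ ^ 2 * ρ w) ≤ ∫ w in S, ‖g w‖ ^ 2 * ρ w := by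
    refine integral_mono ((hre.const_mul 2).sub (hρi.const_mul _))
      (integrableOn_of_isBounded (by fun_prop) hS) fun w ↦ ?_
    have hsq : 0 ≤ ‖g w - g 0‖ ^ 2 * ρ w := mul_nonneg (sq_nonneg _) (hρ0 w)
    simp only [hh, ← Complex.normSq_eq_norm_sq, Complex.normSq_apply, Complex.mul_re,
      Complex.mul_im, Complex.conj_re, Complex.conj_im, Complex.sub_re, Complex.sub_im,
      Complex.ofReal_re, Complex.ofReal_im] at hsq ⊢
    linarith
  rw [integral_sub (hre.const_mul 2) (hρi.const_mul _), integral_const_mul, integral_const_mul,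
    hmean] at hle
  linarith

lemma integral_exp_neg_mul_pow_div_factorial (m : ℕ) (C : ℝ) :
    ∫ t in (0 : ℝ)..C, Real.exp (-t) * t ^ m / (m.factorial : ℝ) =
      1 - Real.exp (-C) * ∑ k ∈ Finset.range (m + 1), C ^ k / (k.factorial : ℝ) := by
  have hsum (m : ℕ) (t : ℝ) :
      HasDerivAt (fun t : ℝ ↦ ∑ k ∈ Finset.range (m + 1), t ^ k / (k.factorial : ℝ))
        (∑ k ∈ Finset.range m, t ^ k / (k.factorial : ℝ)) t := by
    induction m with
    | zero => simpa using hasDerivAt_const t (1 : ℝ)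
    | succ m ih =>
      simp_rw [Finset.sum_range_succ _ (m + 1)]
      rw [Finset.sum_range_succ _ m]
      refine ih.add (((hasDerivAt_pow (m + 1) t).div_const _).congr_deriv ?_)
      rw [Nat.factorial_succ]
      push_cast
      have : (m.factorial : ℝ) ≠ 0 := by positivity
      have : (m : ℝ) + 1 ≠ 0 := by positivity
      field_simp
  have hder (t : ℝ) : HasDerivAt
      (fun t : ℝ ↦ -(Real.exp (-t) * ∑ k ∈ Finset.range (m + 1), t ^ k / (k.factorial : ℝ)))
      (Real.exp (-t) * t ^ m / (m.factorial : ℝ)) t := by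
    refine (((hasDerivAt_neg t).exp.mul (hsum m t)).neg).congr_deriv ?_
    rw [Finset.sum_range_succ]
    ring
  rw [intervalIntegral.integral_eq_sub_of_hasDerivAt (fun t _ ↦ hder t)
    (Continuous.intervalIntegrable (by fun_prop) _ _)]
  simp [Finset.sum_range_succ']
  ring

/-- The volume of the Euclidean ball `{π|w|² < t}` in `ℂⁿ`. -/
lemma volume_real_pi_mul_sum_norm_sq_lt {n : ℕ} (hn : 1 ≤ n) {t : ℝ} (ht : 0 ≤ t) :
    volume.real {w : Fin n → ℂ | Real.pi * ∑ j, ‖w j‖ ^ 2 < t} = t ^ n / (n.factorial : ℝ) := by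
  have : Nonempty (Fin n) := ⟨⟨0, hn⟩⟩
  have hset : {w : Fin n → ℂ | Real.pi * ∑ j, ‖w j‖ ^ 2 < t} =
      {w : Fin n → ℂ | (∑ j, ‖w j‖ ^ (2 : ℝ)) ^ (1 / (2 : ℝ)) < √(t / Real.pi)} := by
    ext w
    simp only [Set.mem_ofPred_eq, Real.rpow_two, ← Real.sqrt_eq_rpow]
    rw [Real.sqrt_lt_sqrt_iff (by positivity), lt_div_iff₀' Real.pi_pos]
  have hvol := Complex.volume_sum_rpow_lt (Fin n) one_le_two √(t / Real.pi)
  rw [hset, measureReal_def, hvol]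
  have h2 : (2 * (n : ℝ) / 2 + 1) = n + 1 := by ring
  rw [Fintype.card_fin, h2, Real.Gamma_nat_eq_factorial, ENNReal.toReal_mul, ENNReal.toReal_pow,
    ENNReal.toReal_ofReal (Real.sqrt_nonneg _), pow_mul, Real.sq_sqrt (by positivity)]
  norm_num [Real.Gamma_two]
  rw [ENNReal.toReal_ofReal (by positivity), div_pow]
  field_simp

lemma isBounded_pi_mul_sum_norm_sq_lt (n : ℕ) (C : ℝ) :
    Bornology.IsBounded {w : Fin n → ℂ | Real.pi * ∑ j, ‖w j‖ ^ 2 < C} := by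
  refine isBounded_iff_forall_norm_le.2 ⟨√(C / Real.pi), fun w hw ↦ ?_⟩
  refine (pi_norm_le_iff_of_nonneg (Real.sqrt_nonneg _)).2 fun j ↦ Real.le_sqrt_of_sq_le ?_
  have h1 : ‖w j‖ ^ 2 ≤ ∑ j, ‖w j‖ ^ 2 :=
    Finset.single_le_sum (f := fun j ↦ ‖w j‖ ^ 2) (fun _ _ ↦ sq_nonneg _) (Finset.mem_univ j)
  exact h1.trans ((le_div_iff₀' Real.pi_pos).2 (le_of_lt hw))

lemma exp_neg_eq_add_integral_indicator {a C : ℝ} (ha : 0 ≤ a) (haC : a ≤ C) :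
    Real.exp (-a) = Real.exp (-C) +
      ∫ t in (0 : ℝ)..C, (Set.Ioi a).indicator (fun t ↦ Real.exp (-t)) t := by
  have hIoc : Set.Ioc 0 C ∩ Set.Ioi a = Set.Ioc a C := by
    ext t
    simp only [Set.mem_inter_iff, Set.mem_Ioc, Set.mem_Ioi]
    constructor
    · tauto
    · exact fun h ↦ ⟨⟨ha.trans_lt h.1, h.2⟩, h.1⟩
  rw [intervalIntegral.integral_of_le (ha.trans haC), setIntegral_indicator measurableSet_Ioi,
    hIoc, ← intervalIntegral.integral_of_le haC]
  have := intervalIntegral.integral_eq_sub_of_hasDerivAt (a := a) (b := C)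
    (f := fun t ↦ -Real.exp (-t)) (f' := fun t ↦ Real.exp (-t))
    (fun t _ ↦ ((hasDerivAt_neg t).exp.neg).congr_deriv (by ring))
    (Continuous.intervalIntegrable (by fun_prop) _ _)
  rw [this]
  ring

/-- The Gaussian mass of the ball `{π|w|² < C}` in `ℂⁿ`. -/
lemma setIntegral_gaussian_ball {n : ℕ} (hn : 1 ≤ n) {C : ℝ} (hC : 0 < C) :
    ∫ w in {w : Fin n → ℂ | Real.pi * ∑ j, ‖w j‖ ^ 2 < C},
        Real.exp (-Real.pi * ∑ j, ‖w j‖ ^ 2) =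
      1 - Real.exp (-C) * ∑ k ∈ Finset.range n, C ^ k / (k.factorial : ℝ) := by
  set T : (Fin n → ℂ) → ℝ := fun w ↦ Real.pi * ∑ j, ‖w j‖ ^ 2 with hT
  have hTc : Continuous T := by fun_prop
  have hT0 (w) : 0 ≤ T w := by positivity
  set B : Set (Fin n → ℂ) := {w | T w < C} with hB
  have hBb : Bornology.IsBounded B := isBounded_pi_mul_sum_norm_sq_lt n C
  have hBm : MeasurableSet B := measurableSet_lt hTc.measurable measurable_const
  set φ : ℝ → (Fin n → ℂ) → ℝ :=
    fun t w ↦ (Set.Ioi (T w)).indicator (fun t ↦ Real.exp (-t)) t with hφ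
  have hφi : Integrable (Function.uncurry φ)
      ((volume.restrict (Set.uIoc 0 C)).prod (volume.restrict B)) := by
    rw [Measure.prod_restrict]
    have hm : MeasurableSet {p : ℝ × (Fin n → ℂ) | T p.2 < p.1} :=
      measurableSet_lt (by fun_prop) (by fun_prop)
    exact (integrableOn_of_isBounded (f := fun p : ℝ × (Fin n → ℂ) ↦ Real.exp (-p.1))
      (by fun_prop)
      (((Metric.isBounded_Icc _ _).subset Set.uIoc_subset_uIcc).prod hBb)).indicator hm
  have hinner (t : ℝ) (ht : t ∈ Set.uIcc 0 C) :
      ∫ w in B, φ t w = Real.exp (-t) * t ^ n / (n.factorial : ℝ) := by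
    rw [Set.uIcc_of_le hC.le] at ht
    have hm : MeasurableSet {w | T w < t} := measurableSet_lt hTc.measurable measurable_const
    have hφt : φ t = {w | T w < t}.indicator fun _ ↦ Real.exp (-t) := rfl
    have hsub : B ∩ {w | T w < t} = {w | T w < t} :=
      Set.inter_eq_right.2 fun w hw ↦ lt_of_lt_of_le hw ht.2
    rw [hφt, setIntegral_indicator hm, hsub, setIntegral_const,
      volume_real_pi_mul_sum_norm_sq_lt hn ht.1, smul_eq_mul]
    ring
  have hBi (f : ℝ) : IntegrableOn (fun _ ↦ f) B := integrableOn_of_isBounded continuous_const hBb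
  calc ∫ w in B, Real.exp (-Real.pi * ∑ j, ‖w j‖ ^ 2)
      = ∫ w in B, (Real.exp (-C) + ∫ t in (0 : ℝ)..C, φ t w) := by
        refine setIntegral_congr_fun hBm fun w hw ↦ ?_
        simp only [neg_mul]
        exact exp_neg_eq_add_integral_indicator (hT0 w) (le_of_lt hw)
    _ = Real.exp (-C) * (C ^ n / (n.factorial : ℝ)) + ∫ t in (0 : ℝ)..C, ∫ w in B, φ t w := by
        rw [integral_add (hBi _), intervalIntegral_integral_swap hφi, setIntegral_const,
          volume_real_pi_mul_sum_norm_sq_lt hn hC.le, smul_eq_mul, mul_comm]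
        simp_rw [intervalIntegral.integral_of_le hC.le]
        rw [Set.uIoc_of_le hC.le] at hφi
        exact hφi.integral_prod_right
    _ = _ := by
        rw [intervalIntegral.integral_congr hinner, integral_exp_neg_mul_pow_div_factorial,
          Finset.sum_range_succ]
        ring

/-- Translating the Gaussian weight amounts to multiplying by the modulus of an exponential. -/
lemma gaussian_add_eq {n : ℕ} (γ w : Fin n → ℂ) :
    Real.exp (-Real.pi * ∑ j, ‖w j + γ j‖ ^ 2) =
      Real.exp (-Real.pi * ∑ j, ‖γ j‖ ^ 2) *
        (‖cexp (-Real.pi * ∑ j, (starRingEnd ℂ) (γ j) * w j)‖ ^ 2 *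
          Real.exp (-Real.pi * ∑ j, ‖w j‖ ^ 2)) := by
  rw [Complex.norm_exp, ← Real.exp_nat_mul, ← Real.exp_add, ← Real.exp_add]
  congr 1
  have hre : (-(Real.pi : ℂ) * ∑ j, (starRingEnd ℂ) (γ j) * w j).re =
      -Real.pi * ∑ j, ((starRingEnd ℂ) (γ j) * w j).re := by
    rw [← Complex.ofReal_neg, Complex.re_ofReal_mul, Complex.re_sum]
  rw [hre]
  have hj (j) : ‖w j + γ j‖ ^ 2 =
      ‖γ j‖ ^ 2 + 2 * ((starRingEnd ℂ) (γ j) * w j).re + ‖w j‖ ^ 2 := by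
    simp only [← Complex.normSq_eq_norm_sq, Complex.normSq_apply, Complex.mul_re,
      Complex.conj_re, Complex.conj_im, Complex.add_re, Complex.add_im]
    ring
  simp only [hj, Finset.sum_add_distrib, ← Finset.mul_sum]
  push_cast
  ring

/-- for an entire `F` on `ℂⁿ`, a point `γ` and `C > 0`, the weighted mass of
`F` on the ball `{π|z−γ|² < C}` is at least `|F(γ)|² e^{-π|γ|²} (1 - e^{-C} ∑_{k<n} C^k/k!)`;
moreover this factor equals `∫₀^C e^{-t} t^{n-1}/(n-1)! dt`. -/
theorem fock_ball_lower_bound (n : ℕ) (hn : 1 ≤ n) (F : (Fin n → ℂ) → ℂ)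
    (hF : Differentiable ℂ F) (γ : Fin n → ℂ) (C : ℝ) (hC : 0 < C) :
    ‖F γ‖ ^ 2 * Real.exp (-Real.pi * ∑ j, ‖γ j‖ ^ 2) *
        (1 - Real.exp (-C) * ∑ k ∈ Finset.range n, C ^ k / (Nat.factorial k : ℝ)) ≤
      (∫ z in {z : Fin n → ℂ | Real.pi * ∑ j, ‖z j - γ j‖ ^ 2 < C},
        ‖F z‖ ^ 2 * Real.exp (-Real.pi * ∑ j, ‖z j‖ ^ 2)) ∧
    1 - Real.exp (-C) * ∑ k ∈ Finset.range n, C ^ k / (Nat.factorial k : ℝ) =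
      ∫ t in (0:ℝ)..C, Real.exp (-t) * t ^ (n - 1) / (Nat.factorial (n - 1) : ℝ) := by
  refine ⟨?_, ?_⟩
  · set B : Set (Fin n → ℂ) := {w | Real.pi * ∑ j, ‖w j‖ ^ 2 < C} with hB
    set G : (Fin n → ℂ) → ℂ :=
      fun w ↦ F (w + γ) * cexp (-Real.pi * ∑ j, (starRingEnd ℂ) (γ j) * w j) with hG
    have hGd : Differentiable ℂ G := by fun_prop
    have hnorm (c : ℂ) (hc : ‖c‖ = 1) (w : Fin n → ℂ) :
        ∑ j, ‖(c • w) j‖ ^ 2 = ∑ j, ‖w j‖ ^ 2 := by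
      simp [hc]
    have hmain := norm_sq_mul_setIntegral_le (isBounded_pi_mul_sum_norm_sq_lt n C)
      (fun c hc w ↦ by simp only [Set.mem_ofPred_eq, hnorm c hc])
      (ρ := fun w ↦ Real.exp (-Real.pi * ∑ j, ‖w j‖ ^ 2)) (by fun_prop)
      (fun w ↦ (Real.exp_pos _).le) (fun c hc w ↦ by simp only [hnorm c hc]) hGd
    have hG0 : G 0 = F γ := by simp [hG]
    rw [setIntegral_gaussian_ball hn hC, hG0] at hmain
    have htrans := (measurePreserving_add_right volume γ).setIntegral_preimage_emb
      (measurableEmbedding_addRight γ)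
      (fun z ↦ ‖F z‖ ^ 2 * Real.exp (-Real.pi * ∑ j, ‖z j‖ ^ 2))
      {z | Real.pi * ∑ j, ‖z j - γ j‖ ^ 2 < C}
    have hpre : (fun w : Fin n → ℂ ↦ w + γ) ⁻¹' {z | Real.pi * ∑ j, ‖z j - γ j‖ ^ 2 < C} = B := by
      ext w
      simp [hB]
    rw [← htrans, hpre]
    have hint (w : Fin n → ℂ) :
        ‖F (w + γ)‖ ^ 2 * Real.exp (-Real.pi * ∑ j, ‖(w + γ) j‖ ^ 2) =
          Real.exp (-Real.pi * ∑ j, ‖γ j‖ ^ 2) *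
            (‖G w‖ ^ 2 * Real.exp (-Real.pi * ∑ j, ‖w j‖ ^ 2)) := by
      simp only [Pi.add_apply, gaussian_add_eq, hG, norm_mul]
      ring
    simp only [hint, integral_const_mul]
    rw [mul_right_comm, mul_comm]
    exact mul_le_mul_of_nonneg_left hmain (Real.exp_pos _).le
  · obtain ⟨m, rfl⟩ := Nat.exists_eq_add_of_le' hn
    exact (integral_exp_neg_mul_pow_div_factorial m C).symm
end
end

section
/- Let φ : ℝⁿ → ℝ be a smooth function whose Hessian is everywhere positive definite, and let A ⊂ ℝⁿ be a closed set. Define the Legendre transform φ*(α) := sup_{y∈ℝⁿ} (α·y − φ(y)) and the iterated Legendre transform φ_A(x) := sup_{α∈A} (α·x − φ*(α)). Then {x ∈ ℝⁿ : φ(x) = φ_A(x)} = {x ∈ ℝⁿ : ∇φ(x) ∈ A}. -/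
open scoped BigOperators

noncomputable section

/-- Euclidean dot product on `ℝⁿ`. -/
def rdot {n : ℕ} (a b : Fin n → ℝ) : ℝ := ∑ j, a j * b j

/-- The Legendre transform `φ*(α) = sup_y (α·y − φ(y))`, with values in `ℝ ∪ {+∞} ⊆ EReal`. -/
def legendre {n : ℕ} (φ : (Fin n → ℝ) → ℝ) (α : Fin n → ℝ) : EReal :=
  ⨆ y : Fin n → ℝ, ((rdot α y - φ y : ℝ) : EReal)

/-- The iterated Legendre transform `φ_A(x) = sup_{α ∈ A} (α·x − φ*(α))`. -/
def legendreIter {n : ℕ} (φ : (Fin n → ℝ) → ℝ) (A : Set (Fin n → ℝ)) (x : Fin n → ℝ) : EReal :=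
  ⨆ α : A, (((rdot (α : Fin n → ℝ) x : ℝ) : EReal) - legendre φ (α : Fin n → ℝ))

/-- The gradient of `φ` at `x`, as a vector of `ℝⁿ`. -/
def gradVec {n : ℕ} (φ : (Fin n → ℝ) → ℝ) (x : Fin n → ℝ) : Fin n → ℝ :=
  fun j => fderiv ℝ φ x (Pi.single j 1)

/-- A twice continuously differentiable function with nonnegative Hessian lies above its tangent
planes. -/
theorem add_fderiv_sub_le_of_hessian_nonneg {E : Type*} [NormedAddCommGroup E] [NormedSpace ℝ E]
    {f : E → ℝ} (hf : ContDiff ℝ 2 f) (hess : ∀ x v, 0 ≤ fderiv ℝ (fderiv ℝ f) x v v) (x y : E) :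
    f x + fderiv ℝ f x (y - x) ≤ f y := by
  have hline (t : ℝ) : HasDerivAt (fun t : ℝ => x + t • (y - x)) (y - x) t := by
    simpa using ((hasDerivAt_id t).smul_const (y - x)).const_add x
  have hf' : Differentiable ℝ (fderiv ℝ f) :=
    (hf.fderiv_right (m := 1) (by norm_num)).differentiable (by norm_num)
  have h1 (t : ℝ) : HasDerivAt (fun t : ℝ => f (x + t • (y - x)))
      (fderiv ℝ f (x + t • (y - x)) (y - x)) t :=
    ((hf.differentiable (by norm_num)) _).hasFDerivAt.comp_hasDerivAt t (hline t)
  have h2 (t : ℝ) : HasDerivAt (fun t : ℝ => fderiv ℝ f (x + t • (y - x)) (y - x))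
      (fderiv ℝ (fderiv ℝ f) (x + t • (y - x)) (y - x) (y - x)) t := by
    simpa using
      ((hf' _).hasFDerivAt.comp_hasDerivAt t (hline t)).clm_apply (hasDerivAt_const t (y - x))
  have hderiv : deriv (fun t : ℝ => f (x + t • (y - x))) =
      fun t => fderiv ℝ f (x + t • (y - x)) (y - x) := funext fun t => (h1 t).deriv
  have hconvex : ConvexOn ℝ Set.univ (fun t : ℝ => f (x + t • (y - x))) := by
    refine convexOn_univ_of_deriv2_nonneg (fun t => (h1 t).differentiableAt) ?_ fun t => ?_
    · rw [hderiv]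
      exact fun t => (h2 t).differentiableAt
    · simp only [Function.iterate_succ, Function.iterate_zero, Function.comp_apply, id_eq]
      rw [hderiv, (h2 t).deriv]
      exact hess _ _
  have hslope := hconvex.le_slope_of_hasDerivAt (Set.mem_univ 0) (Set.mem_univ 1) one_pos (h1 0)
  rw [slope_def_field] at hslope
  simp only [zero_smul, one_smul, add_zero, add_sub_cancel, sub_zero, div_one] at hslope
  linarith

theorem rdot_add_right {n : ℕ} (a b c : Fin n → ℝ) : rdot a (b + c) = rdot a b + rdot a c :=
  dotProduct_add a b c

theorem rdot_gradVec {n : ℕ} (φ : (Fin n → ℝ) → ℝ) (x v : Fin n → ℝ) :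
    rdot (gradVec φ x) v = fderiv ℝ φ x v := by
  have h := LinearMap.pi_apply_eq_sum_univ (fderiv ℝ φ x : (Fin n → ℝ) →ₗ[ℝ] ℝ) v
  simp only [ContinuousLinearMap.coe_coe, smul_eq_mul] at h
  rw [h]
  refine Finset.sum_congr rfl fun j _ => ?_
  rw [mul_comm, gradVec]
  congr 2
  ext i
  simp [Pi.single_apply, eq_comm]

theorem legendreIter_le {n : ℕ} (φ : (Fin n → ℝ) → ℝ) (A : Set (Fin n → ℝ)) (x : Fin n → ℝ) :
    legendreIter φ A x ≤ φ x := by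
  refine iSup_le fun α => ?_
  have h : ((rdot α x - φ x : ℝ) : EReal) ≤ legendre φ α :=
    le_iSup (fun y => ((rdot α y - φ y : ℝ) : EReal)) x
  refine (EReal.sub_le_sub le_rfl h).trans ?_
  rw [← EReal.coe_sub, sub_sub_cancel]

theorem le_legendreIter {n : ℕ} {φ : (Fin n → ℝ) → ℝ} {A : Set (Fin n → ℝ)} {x α : Fin n → ℝ}
    (hα : α ∈ A) (h : ∀ y, rdot α y - φ y ≤ rdot α x - φ x) : φ x ≤ legendreIter φ A x := by
  have hle : legendre φ α ≤ ((rdot α x - φ x : ℝ) : EReal) :=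
    iSup_le fun y => EReal.coe_le_coe_iff.2 (h y)
  calc (φ x : EReal) = (rdot α x : EReal) - ((rdot α x - φ x : ℝ) : EReal) := by
        rw [← EReal.coe_sub, sub_sub_cancel]
    _ ≤ (rdot α x : EReal) - legendre φ α := EReal.sub_le_sub le_rfl hle
    _ ≤ legendreIter φ A x :=
        le_iSup (fun β : A => (rdot (β : Fin n → ℝ) x : EReal) - legendre φ β) ⟨α, hα⟩

theorem exists_rdot_sub_le_of_lt_legendreIter {n : ℕ} {φ : (Fin n → ℝ) → ℝ}
    {A : Set (Fin n → ℝ)} {x : Fin n → ℝ} {c : ℝ} (h : (c : EReal) < legendreIter φ A x) :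
    ∃ α ∈ A, ∀ y, rdot α y - φ y ≤ rdot α x - c := by
  obtain ⟨⟨α, hα⟩, hlt⟩ := lt_iSup_iff.1 h
  refine ⟨α, hα, fun y => ?_⟩
  have hy : ((rdot α y - φ y : ℝ) : EReal) ≤ legendre φ α :=
    le_iSup (fun y => ((rdot α y - φ y : ℝ) : EReal)) y
  have hlt' := hlt.trans_le (EReal.sub_le_sub le_rfl hy)
  rw [← EReal.coe_sub, EReal.coe_lt_coe_iff] at hlt'
  linarith

/-- Approximate subgradients of a function at a point of differentiability are close to its
gradient. -/
theorem exists_pos_forall_dist_gradVec_le {n : ℕ} {φ : (Fin n → ℝ) → ℝ} {x : Fin n → ℝ}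
    (hφ : DifferentiableAt ℝ φ x) {δ : ℝ} (hδ : 0 < δ) :
    ∃ ε > 0, ∀ α : Fin n → ℝ, (∀ y, rdot α y - φ y ≤ rdot α x - (φ x - ε)) →
      dist (gradVec φ x) α ≤ δ := by
  have ho := (hasFDerivAt_iff_isLittleO_nhds_zero.1 hφ.hasFDerivAt).def (half_pos hδ)
  obtain ⟨r, hr, hball⟩ := Metric.eventually_nhds_iff.1 ho
  have ht : 0 < r / 2 := half_pos hr
  refine ⟨δ / 2 * (r / 2), by positivity, fun α hα => (dist_pi_le_iff hδ.le).2 fun j => ?_⟩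
  have key (s : ℝ) (hs : |s| = r / 2) : s * (α j - gradVec φ x j) ≤ δ * (r / 2) := by
    have hnorm : ‖(Pi.single j s : Fin n → ℝ)‖ = r / 2 := by
      rw [Pi.norm_single, Real.norm_eq_abs, hs]
    have hb := hball (y := Pi.single j s) (by rw [dist_zero_right, hnorm]; linarith)
    rw [hnorm, ← rdot_gradVec] at hb
    have hb' := (le_abs_self _).trans hb
    have ha := hα (x + Pi.single j s)
    rw [rdot_add_right] at ha
    have hsingle (β : Fin n → ℝ) : rdot β (Pi.single j s) = β j * s := dotProduct_single β s j
    rw [hsingle] at ha hb'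
    linarith
  have hpos := key (r / 2) (abs_of_pos ht)
  have hneg := key (-(r / 2)) (by rw [abs_neg, abs_of_pos ht])
  rw [Real.dist_eq, abs_le]
  constructor <;> nlinarith

/-- for smooth `φ` with everywhere positive definite Hessian and closed
`A ⊆ ℝⁿ`, the contact set `{φ = φ_A}` equals `{x : ∇φ(x) ∈ A}`. -/
theorem legendre_contact_set (n : ℕ) (φ : (Fin n → ℝ) → ℝ)
    (hφ : ContDiff ℝ (⊤ : ℕ∞) φ)
    (hconv : ∀ x v : Fin n → ℝ, v ≠ 0 → 0 < iteratedFDeriv ℝ 2 φ x ![v, v])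
    (A : Set (Fin n → ℝ)) (hA : IsClosed A) :
    {x : Fin n → ℝ | ((φ x : ℝ) : EReal) = legendreIter φ A x} =
      {x : Fin n → ℝ | gradVec φ x ∈ A} := by
  have hess (x v : Fin n → ℝ) : 0 ≤ fderiv ℝ (fderiv ℝ φ) x v v := by
    rcases eq_or_ne v 0 with rfl | hv
    · simp
    · simpa [iteratedFDeriv_two_apply] using (hconv x v hv).le
  ext x
  refine ⟨fun hx => ?_, fun hx => le_antisymm (le_legendreIter hx fun y => ?_)
    (legendreIter_le φ A x)⟩
  · have hx' : (φ x : EReal) = legendreIter φ A x := hx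
    refine hA.closure_subset (Metric.mem_closure_iff.2 fun δ hδ => ?_)
    obtain ⟨ε, hε, hclose⟩ := exists_pos_forall_dist_gradVec_le
      (hφ.differentiable (by simp) x) (half_pos hδ)
    have hlt : ((φ x - ε : ℝ) : EReal) < legendreIter φ A x := by
      rw [← hx', EReal.coe_lt_coe_iff]
      linarith
    obtain ⟨α, hα, hsub⟩ := exists_rdot_sub_le_of_lt_legendreIter hlt
    exact ⟨α, hα, (hclose α hsub).trans_lt (half_lt_self hδ)⟩
  · have htangent := add_fderiv_sub_le_of_hessian_nonneg (hφ.of_le (by norm_cast))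
      hess x y
    have hsplit := rdot_add_right (gradVec φ x) x (y - x)
    rw [add_sub_cancel, rdot_gradVec φ x (y - x)] at hsplit
    linarith
end
end

section
/- Let φ : ℝⁿ → ℝ be a smooth function whose Hessian is everywhere positive definite, and let A ⊂ ℝⁿ be a closed set. Define φ*(α) := sup_{y∈ℝⁿ} (α·y − φ(y)) and φ_A(x) := sup_{α∈A} (α·x − φ*(α)). If x belongs to the Hele–Shaw domain Ω_A(φ) := {x ∈ ℝⁿ : φ_A(x) < φ(x)}, then φ_A(x) = sup_{α ∈ ∂A} (α·x − φ*(α)), where ∂A denotes the topological boundary of A. -/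
open scoped BigOperators

noncomputable section

theorem rdot_add_smul_left {n : ℕ} (a b : ℝ) (α β y : Fin n → ℝ) :
    rdot (a • α + b • β) y = a * rdot α y + b * rdot β y := by
  simp only [rdot, Finset.mul_sum, ← Finset.sum_add_distrib]
  exact Finset.sum_congr rfl fun j _ => by simp; ring

theorem rdot_sub_right {n : ℕ} (α x y : Fin n → ℝ) :
    rdot α (y - x) = rdot α y - rdot α x := by
  simp [rdot, mul_sub]

/-- A twice differentiable function with nonnegative Hessian lies above its tangent planes. -/
theorem add_fderiv_le_of_iteratedFDeriv_two_nonneg {E : Type*} [NormedAddCommGroup E]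
    [NormedSpace ℝ E] {φ : E → ℝ} (hφ : ContDiff ℝ 2 φ)
    (hconv : ∀ x v : E, 0 ≤ iteratedFDeriv ℝ 2 φ x ![v, v]) (x y : E) :
    φ x + fderiv ℝ φ x (y - x) ≤ φ y := by
  set v := y - x with hv
  have hline (t : ℝ) : HasDerivAt (fun t : ℝ => x + t • v) v t := by
    simpa using ((hasDerivAt_id t).smul_const v).const_add x
  have hφ' : Differentiable ℝ (fderiv ℝ φ) :=
    (hφ.fderiv_right (m := 1) (by norm_num)).differentiable (by norm_num)
  have hg (t : ℝ) : HasDerivAt (fun t : ℝ => φ (x + t • v)) (fderiv ℝ φ (x + t • v) v) t :=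
    ((hφ.differentiable (by norm_num)) (x + t • v)).hasFDerivAt.comp_hasDerivAt t (hline t)
  have hg' (t : ℝ) : HasDerivAt (fun t : ℝ => fderiv ℝ φ (x + t • v) v)
      (fderiv ℝ (fderiv ℝ φ) (x + t • v) v v) t := by
    have h := (hφ' (x + t • v)).hasFDerivAt.comp_hasDerivAt t (hline t)
    simpa using h.clm_apply (hasDerivAt_const t v)
  have hmono : Monotone fun t : ℝ => fderiv ℝ φ (x + t • v) v := by
    refine monotone_of_deriv_nonneg (fun t => (hg' t).differentiableAt) fun t => ?_
    rw [(hg' t).deriv]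
    simpa [iteratedFDeriv_two_apply] using hconv (x + t • v) v
  obtain ⟨c, hc, hslope⟩ := exists_hasDerivAt_eq_slope (fun t : ℝ => φ (x + t • v)) _
    zero_lt_one (fun t _ => (hg t).continuousAt.continuousWithinAt) (fun t _ => hg t)
  have h0c := hmono hc.1.le
  have hxy : x + v = y := by simp [hv]
  simp only [one_smul, zero_smul, add_zero, sub_zero, div_one, hxy] at hslope h0c
  linarith

theorem IsPreconnected.inter_frontier_nonempty {X : Type*} [TopologicalSpace X] {s t : Set X}
    (ht : IsPreconnected t) (h : (t ∩ s).Nonempty) (h' : (t ∩ sᶜ).Nonempty) :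
    (t ∩ frontier s).Nonempty := by
  by_contra hfr
  have hmem {z : X} (hz : z ∈ t) (hzc : z ∈ closure s) : z ∈ interior s := by
    by_contra hzi
    exact hfr ⟨z, hz, hzc, hzi⟩
  obtain ⟨a, hat, has⟩ := h
  obtain ⟨b, hbt, hbs⟩ := h'
  obtain ⟨z, -, hzi, hzc⟩ := ht (interior s) (closure s)ᶜ isOpen_interior
    isClosed_closure.isOpen_compl
    (fun z hz => (em (z ∈ closure s)).imp (hmem hz) id)
    ⟨a, hat, hmem hat (subset_closure has)⟩
    ⟨b, hbt, fun hb => hbs (interior_subset (hmem hbt hb))⟩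
  exact hzc (interior_subset_closure hzi)

theorem exists_rdot_eq {n : ℕ} (L : (Fin n → ℝ) →L[ℝ] ℝ) :
    ∃ p : Fin n → ℝ, ∀ v, rdot p v = L v := by
  refine ⟨fun j => L (Pi.single j 1), fun v => ?_⟩
  conv_rhs => rw [← LinearMap.sum_single_apply (fun _ => ℝ) v, map_sum]
  refine Finset.sum_congr rfl fun j _ => ?_
  have h : (Pi.single j (v j) : Fin n → ℝ) = v j • Pi.single j 1 := by
    rw [← Pi.single_smul]; simp
  simp [h, mul_comm]

theorem legendre_le_iff {n : ℕ} {φ : (Fin n → ℝ) → ℝ} {α : Fin n → ℝ} {c : ℝ} :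
    legendre φ α ≤ (c : EReal) ↔ ∀ y, rdot α y - φ y ≤ c := by
  simp only [legendre, iSup_le_iff, EReal.coe_le_coe_iff]

theorem coe_le_sub_legendre_iff {n : ℕ} {φ : (Fin n → ℝ) → ℝ} {α x : Fin n → ℝ} {c : ℝ} :
    (c : EReal) ≤ ((rdot α x : ℝ) : EReal) - legendre φ α ↔
      ∀ y, rdot α y - φ y ≤ rdot α x - c := by
  rw [← legendre_le_iff]
  have hbot : legendre φ α ≠ ⊥ :=
    ((EReal.bot_lt_coe _).trans_le (le_iSup (fun y => ((rdot α y - φ y : ℝ) : EReal)) 0)).ne'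
  generalize legendre φ α = l at hbot
  induction l with
  | bot => exact absurd rfl hbot
  | top => simpa using EReal.coe_ne_top (rdot α x - c)
  | coe r =>
    rw [← EReal.coe_sub, EReal.coe_le_coe_iff, EReal.coe_le_coe_iff]
    constructor <;> intro h <;> linarith

theorem legendreIter_mono {n : ℕ} (φ : (Fin n → ℝ) → ℝ) {A B : Set (Fin n → ℝ)} (h : A ⊆ B)
    (x : Fin n → ℝ) : legendreIter φ A x ≤ legendreIter φ B x :=
  iSup_le fun α => le_iSup_of_le ⟨α, h α.2⟩ le_rfl

/-- for smooth `φ` with everywhere positive definite Hessian and closed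
`A ⊆ ℝⁿ`, on the Hele–Shaw domain `{φ_A < φ}` the iterated Legendre transform is computed by
the boundary of `A`: `φ_A(x) = sup_{α ∈ ∂A} (α·x − φ*(α))`. -/
theorem legendre_iter_boundary (n : ℕ) (φ : (Fin n → ℝ) → ℝ)
    (hφ : ContDiff ℝ (⊤ : ℕ∞) φ)
    (hconv : ∀ x v : Fin n → ℝ, v ≠ 0 → 0 < iteratedFDeriv ℝ 2 φ x ![v, v])
    (A : Set (Fin n → ℝ)) (hA : IsClosed A)
    (x : Fin n → ℝ) (hx : legendreIter φ A x < ((φ x : ℝ) : EReal)) :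
    legendreIter φ A x = legendreIter φ (frontier A) x := by
  refine le_antisymm ?_ (legendreIter_mono φ hA.frontier_subset x)
  obtain ⟨p, hp⟩ := exists_rdot_eq (fderiv ℝ φ x)
  have htangent (y : Fin n → ℝ) : rdot p y - φ y ≤ rdot p x - φ x := by
    have h := add_fderiv_le_of_iteratedFDeriv_two_nonneg (hφ.of_le (WithTop.coe_le_coe.2 le_top))
      (fun x v => by
        rcases eq_or_ne v 0 with rfl | hv
        · simp [iteratedFDeriv_two_apply]
        · exact (hconv x v hv).le) x y
    rw [← hp, rdot_sub_right] at h
    linarith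
  have hpA : p ∉ A := fun h => hx.not_ge <|
    le_iSup_of_le (⟨p, h⟩ : A) (coe_le_sub_legendre_iff.2 htangent)
  refine iSup_le fun ⟨α, hα⟩ => EReal.ge_of_forall_gt_iff_ge.1 fun c hc => ?_
  have hc := coe_le_sub_legendre_iff.1 hc.le
  obtain ⟨_, ⟨a, b, ha, hb, hab, rfl⟩, hβ⟩ :=
    (convex_segment (𝕜 := ℝ) α p).isPreconnected.inter_frontier_nonempty
      ⟨α, left_mem_segment ℝ α p, hα⟩ ⟨p, right_mem_segment ℝ α p, hpA⟩
  refine le_iSup_of_le (⟨_, hβ⟩ : frontier A) (coe_le_sub_legendre_iff.2 fun y => ?_)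
  have hcx : c ≤ φ x := by linarith [hc x]
  simp only [rdot_add_smul_left]
  obtain rfl : a = 1 - b := by linarith
  nlinarith [mul_le_mul_of_nonneg_left (hc y) ha, mul_le_mul_of_nonneg_left (htangent y) hb,
    mul_le_mul_of_nonneg_left hcx hb]
end
end

section
/- Let τ ∈ ℂ with ε := Im τ > 0 and let ϑ(z;τ) := Σ_{n∈ℤ} e^{2πinz} e^{πin²τ} be the Jacobi theta function. Then for every z ∈ ℂ, |ϑ(z;τ)| · e^{−π(Im z)²/ε} ≤ Σ_{n∈ℤ} e^{−πn²ε}; that is, sup_{z∈ℂ} |ϑ(z;τ)| e^{−π(Im z)²/ε} ≤ Σ_{n∈ℤ} e^{−πn²ε}. -/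
open Complex

noncomputable section

/-- The Jacobi theta function `ϑ(z;τ) = ∑_{n∈ℤ} e^{2πinz} e^{πin²τ}`. -/
def jacobiThetaFn (z τ : ℂ) : ℂ :=
  ∑' n : ℤ, Complex.exp (2 * Real.pi * Complex.I * (n : ℂ) * z) *
    Complex.exp (Real.pi * Complex.I * (n : ℂ) ^ 2 * τ)

/-- The real Gaussian series with a linear term in the exponent converges. -/
theorem summable_exp_neg_quadratic {ε : ℝ} (hε : 0 < ε) (y : ℝ) :
    Summable fun n : ℤ ↦ Real.exp (-Real.pi * (n : ℝ) ^ 2 * ε - 2 * Real.pi * n * y) := by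
  have h := ((summable_jacobiTheta₂_term_iff (y * I) (ε * I)).mpr (by simpa using hε)).norm
  simpa [norm_jacobiTheta₂_term] using h

/-- Completing the square, a translate of the Gaussian has the largest sum over `ℤ` when it is
centred at an integer; this follows from Poisson summation. -/
theorem tsum_exp_neg_quadratic_le {ε : ℝ} (hε : 0 < ε) (y : ℝ) :
    ∑' n : ℤ, Real.exp (-Real.pi * (n : ℝ) ^ 2 * ε - 2 * Real.pi * n * y) ≤
      Real.exp (Real.pi * y ^ 2 / ε) * ∑' n : ℤ, Real.exp (-Real.pi * (n : ℝ) ^ 2 * ε) := by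
  have hnorm (n : ℤ) : ‖cexp (-Real.pi / (ε : ℂ) * (n + I * (-y : ℝ)) ^ 2)‖ =
      Real.exp (Real.pi * y ^ 2 / ε) * Real.exp (-Real.pi / ε * (n : ℝ) ^ 2) := by
    have h : -Real.pi / (ε : ℂ) * (n + I * (-y : ℝ)) ^ 2 =
        ((Real.pi * y ^ 2 / ε + -Real.pi / ε * (n : ℝ) ^ 2 : ℝ) : ℂ) +
          ((2 * Real.pi / ε * n * y : ℝ) : ℂ) * I := by
      push_cast
      ring_nf
      rw [I_sq]
      ring
    rw [h, norm_exp, ← Real.exp_add]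
    simp only [add_re, ofReal_re, re_ofReal_mul, I_re, mul_zero, add_zero]
  have hsum : Summable fun n : ℤ ↦ Real.exp (-Real.pi / ε * (n : ℝ) ^ 2) := by
    refine (summable_exp_neg_quadratic (inv_pos.mpr hε) 0).congr fun n ↦ ?_
    ring_nf
  have hpoisson := Complex.tsum_exp_neg_quadratic (a := ε) (by simpa using hε) ((-y : ℝ) : ℂ)
  have hleft : (∑' n : ℤ, cexp (-Real.pi * ε * n ^ 2 + 2 * Real.pi * (-y : ℝ) * n)) =
      ((∑' n : ℤ, Real.exp (-Real.pi * (n : ℝ) ^ 2 * ε - 2 * Real.pi * n * y) : ℝ) : ℂ) := by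
    rw [ofReal_tsum]
    refine tsum_congr fun n ↦ ?_
    push_cast
    ring_nf
  have hroot : ‖(1 / (ε : ℂ) ^ (1 / 2 : ℂ))‖ = 1 / ε ^ (1 / 2 : ℝ) := by
    rw [norm_div, norm_one, norm_cpow_eq_rpow_re_of_pos hε]
    norm_num
  have hright : ∑' n : ℤ, Real.exp (-Real.pi * (n : ℝ) ^ 2 * ε) =
      1 / ε ^ (1 / 2 : ℝ) * ∑' n : ℤ, Real.exp (-Real.pi / ε * (n : ℝ) ^ 2) := by
    rw [← Real.tsum_exp_neg_mul_int_sq hε]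
    exact tsum_congr fun n ↦ by ring_nf
  rw [hleft] at hpoisson
  calc
    _ ≤ ‖((∑' n : ℤ, Real.exp (-Real.pi * (n : ℝ) ^ 2 * ε - 2 * Real.pi * n * y) : ℝ) : ℂ)‖ := by
      rw [norm_real]
      exact Real.le_norm_self _
    _ = 1 / ε ^ (1 / 2 : ℝ) *
        ‖∑' n : ℤ, cexp (-Real.pi / (ε : ℂ) * (n + I * (-y : ℝ)) ^ 2)‖ := by
      rw [hpoisson, norm_mul, hroot]
    _ ≤ 1 / ε ^ (1 / 2 : ℝ) *
        ∑' n : ℤ, Real.exp (Real.pi * y ^ 2 / ε) * Real.exp (-Real.pi / ε * (n : ℝ) ^ 2) := by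
      gcongr
      simp_rw [← hnorm]
      refine norm_tsum_le_tsum_norm ?_
      simp_rw [hnorm]
      exact hsum.mul_left _
    _ = _ := by
      rw [hright, tsum_mul_left]
      ring

/-- for `Im τ = ε > 0` and every `z ∈ ℂ`,
`|ϑ(z;τ)| e^{-π (Im z)²/ε} ≤ ∑_{n∈ℤ} e^{-π n² ε}`. -/
theorem jacobi_theta_sup_bound (τ : ℂ) (hτ : 0 < τ.im) (z : ℂ) :
    ‖jacobiThetaFn z τ‖ * Real.exp (-Real.pi * (z.im) ^ 2 / τ.im) ≤
      ∑' n : ℤ, Real.exp (-Real.pi * (n : ℝ) ^ 2 * τ.im) := by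
  have hnorm (n : ℤ) : ‖Complex.exp (2 * Real.pi * Complex.I * (n : ℂ) * z) *
      Complex.exp (Real.pi * Complex.I * (n : ℂ) ^ 2 * τ)‖ =
      Real.exp (-Real.pi * (n : ℝ) ^ 2 * τ.im - 2 * Real.pi * n * z.im) := by
    rw [← Complex.exp_add, ← norm_jacobiTheta₂_term, jacobiTheta₂_term]
  have hbound : ‖jacobiThetaFn z τ‖ ≤ Real.exp (Real.pi * z.im ^ 2 / τ.im) *
      ∑' n : ℤ, Real.exp (-Real.pi * (n : ℝ) ^ 2 * τ.im) := by
    refine le_trans ?_ (tsum_exp_neg_quadratic_le hτ z.im)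
    simp_rw [← hnorm]
    refine norm_tsum_le_tsum_norm ?_
    simp_rw [hnorm]
    exact summable_exp_neg_quadratic hτ z.im
  calc
    _ ≤ Real.exp (Real.pi * z.im ^ 2 / τ.im) *
        (∑' n : ℤ, Real.exp (-Real.pi * (n : ℝ) ^ 2 * τ.im)) *
        Real.exp (-Real.pi * z.im ^ 2 / τ.im) := by gcongr
    _ = _ := by
      rw [mul_right_comm, ← Real.exp_add, neg_mul, neg_div, add_neg_cancel, Real.exp_zero, one_mul]
end
end
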